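/- arXiv:1609.07732 — 2 statements merged into one kernel-verified Lean document; each statement's English description precedes it below -/
import Mathlib

section
/- Let Y be an indecomposable non-injective object of C. Then Y lies in C_l if and only if there exists an almost split conflation Y → E → Z in C starting at Y. -/
/-!
Common setup: a Hom-finite Krull-Schmidt `k`-linear abelian category `C`, regarded as an exact
category whose conflations are all short exact sequences.  The Yoneda Ext¹-bifunctor of this
exact structure, together with the assignment of its extension class to each short exact
sequence and the standard pullback/pushout functorialities, is axiomatized by the structure
`YonedaExt` below.  (Over a field, Hom-finiteness together with the existence of an abelian
structure makes `C` Krull-Schmidt automatically.)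
-/

open CategoryTheory CategoryTheory.Limits

universe v u

namespace GenAR

/-- An axiomatization of the Yoneda `Ext¹`-bifunctor of a `k`-linear abelian category `C`
(with the exact structure given by all short exact sequences):  `ext X Y` is the `k`-module
of equivalence classes of conflations `Y → E → X`; `pull f Y` is `Ext(f,Y)` (pullback, i.e.
`μ ↦ μ.f`); `push X g` is `Ext(X,g)` (pushout, i.e. `μ ↦ g.μ`); `cls` assigns to a short
exact sequence its class, which vanishes iff the sequence splits; every class is realized by
a conflation, and pullback/pushout classes are realized by actual pullback/pushout diagrams. -/
structure YonedaExt (k : Type) [Field k] (C : Type u) [Category.{v} C] [Abelian C]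
    [Linear k C] where
  ext : C → C → ModuleCat.{v} k
  pull : ∀ {X' X : C} (_ : X' ⟶ X) (Y : C), ext X Y →ₗ[k] ext X' Y
  push : ∀ (X : C) {Y Y' : C} (_ : Y ⟶ Y'), ext X Y →ₗ[k] ext X Y'
  pull_id : ∀ X Y : C, pull (𝟙 X) Y = LinearMap.id
  pull_comp : ∀ {X'' X' X : C} (f : X'' ⟶ X') (g : X' ⟶ X) (Y : C),
    pull (f ≫ g) Y = (pull f Y).comp (pull g Y)
  pull_zero : ∀ (X' X Y : C), pull (0 : X' ⟶ X) Y = 0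
  pull_add : ∀ {X' X : C} (f g : X' ⟶ X) (Y : C), pull (f + g) Y = pull f Y + pull g Y
  pull_smul : ∀ {X' X : C} (a : k) (f : X' ⟶ X) (Y : C), pull (a • f) Y = a • pull f Y
  push_id : ∀ X Y : C, push X (𝟙 Y) = LinearMap.id
  push_comp : ∀ (X : C) {Y Y' Y'' : C} (g : Y ⟶ Y') (g' : Y' ⟶ Y''),
    push X (g ≫ g') = (push X g').comp (push X g)
  push_zero : ∀ (X Y Y' : C), push X (0 : Y ⟶ Y') = 0
  push_add : ∀ (X : C) {Y Y' : C} (g h : Y ⟶ Y'), push X (g + h) = push X g + push X h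
  push_smul : ∀ (X : C) {Y Y' : C} (a : k) (g : Y ⟶ Y'), push X (a • g) = a • push X g
  pull_push : ∀ {X' X Y Y' : C} (f : X' ⟶ X) (g : Y ⟶ Y'),
    (push X' g).comp (pull f Y) = (pull f Y').comp (push X g)
  cls : ∀ {S : ShortComplex C}, S.ShortExact → ext S.X₃ S.X₁
  cls_eq_zero_iff : ∀ {S : ShortComplex C} (hS : S.ShortExact),
    cls hS = 0 ↔ Nonempty S.Splitting
  cls_surjective : ∀ (X Y : C) (e : ext X Y), ∃ (E : C) (i : Y ⟶ E) (p : E ⟶ X)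
    (w : i ≫ p = 0) (hS : (ShortComplex.mk i p w).ShortExact), cls hS = e
  cls_pull : ∀ {S : ShortComplex C} (hS : S.ShortExact) {Z : C} (f : Z ⟶ S.X₃),
    ∃ (E' : C) (i' : S.X₁ ⟶ E') (p' : E' ⟶ Z) (w' : i' ≫ p' = 0)
      (hS' : (ShortComplex.mk i' p' w').ShortExact) (m : E' ⟶ S.X₂),
      cls hS' = pull f S.X₁ (cls hS) ∧ i' ≫ m = S.f ∧ m ≫ S.g = p' ≫ f
  cls_push : ∀ {S : ShortComplex C} (hS : S.ShortExact) {Z : C} (g : S.X₁ ⟶ Z),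
    ∃ (E' : C) (i' : Z ⟶ E') (p' : E' ⟶ S.X₃) (w' : i' ≫ p' = 0)
      (hS' : (ShortComplex.mk i' p' w').ShortExact) (m : S.X₂ ⟶ E'),
      cls hS' = push S.X₃ g (cls hS) ∧ S.f ≫ m = g ≫ i' ∧ m ≫ p' = S.g

variable {k : Type} [Field k] {C : Type u} [Category.{v} C] [Abelian C] [Linear k C]

/-- The ideal of injectively trivial morphisms `M ⟶ X`, i.e. those `f` with `Ext(Z,f) = 0`
for every `Z`. -/
def ITriv (T : YonedaExt k C) (M X : C) : Submodule k (M ⟶ X) where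
  carrier := {f | ∀ Z : C, T.push Z f = 0}
  add_mem' := by
    intro f g hf hg Z
    rw [T.push_add, hf Z, hg Z, add_zero]
  zero_mem' := fun Z => T.push_zero Z _ _
  smul_mem' := by
    intro a f hf Z
    rw [T.push_smul, hf Z, smul_zero]

lemma mem_ITriv {T : YonedaExt k C} {M X : C} {f : M ⟶ X} :
    f ∈ ITriv T M X ↔ ∀ Z : C, T.push Z f = 0 := Iff.rfl

/-- The ideal of projectively trivial morphisms `M ⟶ X`, i.e. those `f` with `Ext(f,Z) = 0`
for every `Z`. -/
def PTriv (T : YonedaExt k C) (M X : C) : Submodule k (M ⟶ X) where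
  carrier := {f | ∀ Z : C, T.pull f Z = 0}
  add_mem' := by
    intro f g hf hg Z
    rw [T.pull_add, hf Z, hg Z, add_zero]
  zero_mem' := fun Z => T.pull_zero _ _ Z
  smul_mem' := by
    intro a f hf Z
    rw [T.pull_smul, hf Z, smul_zero]

lemma mem_PTriv {T : YonedaExt k C} {M X : C} {f : M ⟶ X} :
    f ∈ PTriv T M X ↔ ∀ Z : C, T.pull f Z = 0 := Iff.rfl

/-- Hom-spaces of the injectively stable category `C̄ = C/I`. -/
abbrev HomBar (T : YonedaExt k C) (M X : C) := (M ⟶ X) ⧸ ITriv T M X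

/-- Hom-spaces of the projectively stable category `C̲ = C/P`. -/
abbrev HomUnder (T : YonedaExt k C) (M X : C) := (M ⟶ X) ⧸ PTriv T M X

/-- `u : X ⟶ E` is left almost split: it is not a section, and every non-section
`X ⟶ Z` factors through it. -/
def IsLeftAlmostSplit {X E : C} (u : X ⟶ E) : Prop :=
  (¬ ∃ r : E ⟶ X, u ≫ r = 𝟙 X) ∧
  ∀ (Z : C) (f : X ⟶ Z), (¬ ∃ r : Z ⟶ X, f ≫ r = 𝟙 X) → ∃ h : E ⟶ Z, u ≫ h = f

/-- `v : E ⟶ Y` is right almost split: it is not a retraction, and every non-retraction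
`Z ⟶ Y` factors through it. -/
def IsRightAlmostSplit {E Y : C} (v : E ⟶ Y) : Prop :=
  (¬ ∃ s : Y ⟶ E, s ≫ v = 𝟙 Y) ∧
  ∀ (Z : C) (f : Z ⟶ Y), (¬ ∃ s : Y ⟶ Z, s ≫ f = 𝟙 Y) → ∃ h : Z ⟶ E, h ≫ v = f

/-- `X → E → Y` is an almost split conflation. -/
def IsAlmostSplitConflation {X E Y : C} (u : X ⟶ E) (v : E ⟶ Y) (w : u ≫ v = 0) : Prop :=
  (ShortComplex.mk u v w).ShortExact ∧ IsLeftAlmostSplit u ∧ IsRightAlmostSplit v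

/-- `Z` is a direct summand of `Y`. -/
def IsDirectSummand (Z Y : C) : Prop := ∃ (i : Z ⟶ Y) (r : Y ⟶ Z), i ≫ r = 𝟙 Z

/-- An indecomposable object. -/
def Indec (Y : C) : Prop :=
  ¬ IsZero Y ∧ ∀ A B : C, Nonempty (Y ≅ A ⊞ B) → IsZero A ∨ IsZero B

/-- Injective object of the exact category: every conflation starting at it splits,
equivalently `Ext(-,X)` vanishes. -/
def IsInjObj (T : YonedaExt k C) (X : C) : Prop := ∀ (Z : C) (e : T.ext Z X), e = 0

/-- Projective object of the exact category: every conflation ending at it splits,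
equivalently `Ext(X,-)` vanishes. -/
def IsProjObj (T : YonedaExt k C) (X : C) : Prop := ∀ (Z : C) (e : T.ext X Z), e = 0

/-- `Yt` represents the functor `D Ext(Y,-) : C̄ → k-Mod`, i.e. there is an isomorphism of
functors `Hom̄(-,Yt) ≅ D Ext(Y,-)`. -/
def RepresentsR (T : YonedaExt k C) (Y Yt : C) : Prop :=
  ∃ e : ∀ M : C, HomBar T M Yt ≃ₗ[k] Module.Dual k (T.ext Y M),
    ∀ (M M' : C) (h : M ⟶ M') (f : M' ⟶ Yt) (μ : T.ext Y M),
      e M (Submodule.Quotient.mk (h ≫ f)) μ = e M' (Submodule.Quotient.mk f) (T.push Y h μ)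

/-- `Xt` represents the functor `D Ext(-,X) : C̲ → k-Mod`, i.e. there is an isomorphism of
functors `Hom̲(Xt,-) ≅ D Ext(-,X)`. -/
def RepresentsL (T : YonedaExt k C) (X Xt : C) : Prop :=
  ∃ e : ∀ M : C, HomUnder T Xt M ≃ₗ[k] Module.Dual k (T.ext M X),
    ∀ (M M' : C) (h : M ⟶ M') (g : Xt ⟶ M) (μ : T.ext M' X),
      e M' (Submodule.Quotient.mk (g ≫ h)) μ = e M (Submodule.Quotient.mk g) (T.pull h X μ)

/-- The full subcategory `C_r`: the functor `D Ext(X,-) : C̄ → k-Mod` is representable. -/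
def MemCr (T : YonedaExt k C) (X : C) : Prop := ∃ Xt : C, RepresentsR T X Xt

/-- The full subcategory `C_l`: the functor `D Ext(-,X) : C̲ → k-Mod` is representable. -/
def MemCl (T : YonedaExt k C) (X : C) : Prop := ∃ Xt : C, RepresentsL T X Xt

/-- `X ≅ Y` in the projectively stable category `C̲`. -/
def StablyIsoP (T : YonedaExt k C) (X Y : C) : Prop :=
  ∃ (f : X ⟶ Y) (g : Y ⟶ X), f ≫ g - 𝟙 X ∈ PTriv T X X ∧ g ≫ f - 𝟙 Y ∈ PTriv T Y Y

/-- `X ≅ Y` in the injectively stable category `C̄`. -/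
def StablyIsoI (T : YonedaExt k C) (X Y : C) : Prop :=
  ∃ (f : X ⟶ Y) (g : Y ⟶ X), f ≫ g - 𝟙 X ∈ ITriv T X X ∧ g ≫ f - 𝟙 Y ∈ ITriv T Y Y

end GenAR
namespace GenAR

variable {k : Type} [Field k] {C : Type u} [Category.{v} C] [Abelian C] [Linear k C]

section FittingDichotomy

open Polynomial

/-- In a finite-dimensional algebra without nontrivial idempotents, every element is nilpotent
or invertible. -/
lemma isNilpotent_or_isUnit_of_idempotents_trivial {k A : Type*} [Field k] [Ring A] [Algebra k A]
    [FiniteDimensional k A] (hA : ∀ e : A, e * e = e → e = 0 ∨ e = 1) (a : A) :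
    IsNilpotent a ∨ IsUnit a := by
  have hp : minpoly k a ≠ 0 := minpoly.ne_zero (Algebra.IsIntegral.isIntegral a)
  obtain ⟨q, hq, hdvd⟩ := exists_eq_pow_rootMultiplicity_mul_and_not_dvd (minpoly k a) hp 0
  set m := (minpoly k a).rootMultiplicity 0
  rw [C_0, sub_zero] at hq hdvd
  have hcop : IsCoprime (X ^ (m + 1)) q :=
    IsCoprime.pow_left ((irreducible_X.coprime_iff_not_dvd).2 hdvd)
  obtain ⟨r, s, hrs⟩ := hcop
  have hzero : aeval a (X ^ (m + 1) * q) = 0 := by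
    rw [pow_succ', mul_assoc, ← hq, map_mul, minpoly.aeval, mul_zero]
  have hidem : r * X ^ (m + 1) * (r * X ^ (m + 1)) =
      r * X ^ (m + 1) - r * s * (X ^ (m + 1) * q) := by
    linear_combination (r * X ^ (m + 1)) * hrs
  rcases hA (aeval a (r * X ^ (m + 1))) (by
    rw [← map_mul, hidem, map_sub, map_mul (aeval a) (r * s), hzero, mul_zero, sub_zero]) with h | h
  · left
    refine ⟨m + 1, ?_⟩
    have h1 : aeval a (X ^ (m + 1) : k[X]) = aeval a (X ^ (m + 1) : k[X]) *
        aeval a (r * X ^ (m + 1)) + aeval a s * aeval a (X ^ (m + 1) * q) := by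
      rw [← map_mul, ← map_mul, ← map_add]
      congr 1
      linear_combination (-X ^ (m + 1)) * hrs
    rw [h, hzero, mul_zero, mul_zero, add_zero] at h1
    simpa using h1
  · right
    have h1 : aeval a (r * X ^ m) * a = 1 := by
      rw [← h, pow_succ, ← mul_assoc, map_mul (aeval a) _ X, aeval_X]
    have h2 : a * aeval a (r * X ^ m) = 1 := by
      rw [← h, pow_succ, ← mul_assoc, mul_comm _ X, map_mul (aeval a) X, aeval_X]
    exact ⟨⟨a, _, h2, h1⟩, rfl⟩

end FittingDichotomy

/-- In a finite-dimensional vector space a vector outside a subspace is detected, on a given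
space in perfect duality with it, by an element orthogonal to the subspace. -/
lemma exists_orthogonal_of_notMem {k V W : Type*} [Field k] [AddCommGroup V] [Module k V]
    [AddCommGroup W] [Module k W] [FiniteDimensional k V] (e : V ≃ₗ[k] Module.Dual k W)
    {N : Submodule k V} {r : V} (hr : r ∉ N) :
    ∃ μ : W, e r μ ≠ 0 ∧ ∀ g ∈ N, e g μ = 0 := by
  have : FiniteDimensional k W :=
    (Module.finite_dual_iff k).1 (Module.Finite.equiv e)
  obtain ⟨ψ, hψ, hN⟩ := N.exists_dual_map_eq_bot_of_notMem hr inferInstance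
  have key : ∀ g, e g ((Module.evalEquiv k W).symm (ψ ∘ₗ e.symm.toLinearMap)) = ψ g := by
    intro g
    rw [Module.apply_evalEquiv_symm_apply]
    simp
  refine ⟨(Module.evalEquiv k W).symm (ψ ∘ₗ e.symm.toLinearMap), ?_, fun g hg => ?_⟩
  · rwa [key]
  · rw [key]
    have : ψ g ∈ N.map ψ := ⟨g, hg, rfl⟩
    rwa [hN] at this

section Indecomposable

lemma Indec.idempotent_trivial {X : C} (hX : Indec X) (e : X ⟶ X) (he : e ≫ e = e) :
    e = 0 ∨ e = 𝟙 X := by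
  obtain ⟨A, i, r, hir, hri⟩ := IsIdempotentComplete.idempotents_split X e he
  obtain ⟨B, j, s, hjs, hsj⟩ := IsIdempotentComplete.idempotents_split X (𝟙 X - e)
    (by simp [he])
  have his : i ≫ s = 0 := by
    calc i ≫ s = (i ≫ r) ≫ i ≫ s ≫ j ≫ s := by rw [hir, hjs]; simp
      _ = i ≫ (r ≫ i) ≫ (s ≫ j) ≫ s := by simp only [Category.assoc]
      _ = 0 := by rw [hri, hsj]; simp [reassoc_of% he]
  have hjr : j ≫ r = 0 := by
    calc j ≫ r = (j ≫ s) ≫ j ≫ r ≫ i ≫ r := by rw [hir, hjs]; simp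
      _ = j ≫ (s ≫ j) ≫ (r ≫ i) ≫ r := by simp only [Category.assoc]
      _ = 0 := by rw [hri, hsj]; simp [reassoc_of% he]
  have iso : X ≅ A ⊞ B :=
    { hom := biprod.lift r s
      inv := biprod.desc i j
      hom_inv_id := by rw [biprod.lift_desc, hri, hsj]; abel
      inv_hom_id := by
        apply biprod.hom_ext' <;> apply biprod.hom_ext <;> simp [hir, hjs, his, hjr] }
  rcases hX.2 A B ⟨iso⟩ with h | h
  · left
    rw [← hri, h.eq_zero_of_tgt r, zero_comp]
  · right
    rw [h.eq_zero_of_tgt s, zero_comp] at hsj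
    exact (sub_eq_zero.1 hsj.symm).symm

/-- Fitting's dichotomy for endomorphisms of an indecomposable object. -/
lemma Indec.isNilpotent_or_isUnit (homFinite : ∀ X Y : C, FiniteDimensional k (X ⟶ Y))
    {X : C} (hX : Indec X) (a : End X) : IsNilpotent a ∨ IsUnit a := by
  have : FiniteDimensional k (End X) := homFinite X X
  exact isNilpotent_or_isUnit_of_idempotents_trivial (k := k) (A := End X)
    (fun e he => hX.idempotent_trivial e he) a

lemma exists_comp_eq_id_of_isUnit {D : Type*} [Category* D] {X : D} {a : End X} (ha : IsUnit a) :
    (∃ b : X ⟶ X, b ≫ a = 𝟙 X) ∧ ∃ b : X ⟶ X, (a : X ⟶ X) ≫ b = 𝟙 X := by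
  obtain ⟨⟨a, b, hab, hba⟩, rfl⟩ := ha
  exact ⟨⟨b, hab⟩, ⟨b, hba⟩⟩

lemma Indec.retraction_of_add_eq_id (homFinite : ∀ X Y : C, FiniteDimensional k (X ⟶ Y))
    {X : C} (hX : Indec X) {a b : X ⟶ X} (hab : a + b = 𝟙 X) :
    (∃ c : X ⟶ X, c ≫ a = 𝟙 X) ∨ ∃ c : X ⟶ X, c ≫ b = 𝟙 X := by
  rcases hX.isNilpotent_or_isUnit homFinite (End.of a) with h | h
  · right
    have h1 := h.isUnit_one_sub
    have h2 : (1 - End.of a : End X) = End.of b := sub_eq_of_eq_add' hab.symm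
    rw [h2] at h1
    exact (exists_comp_eq_id_of_isUnit h1).1
  · exact Or.inl (exists_comp_eq_id_of_isUnit h).1

/-- The non-retractions `M ⟶ X` onto an indecomposable object form a subspace. -/
def nonRetractions (homFinite : ∀ X Y : C, FiniteDimensional k (X ⟶ Y))
    (M : C) {X : C} (hX : Indec X) : Submodule k (M ⟶ X) where
  carrier := {g | ¬ ∃ s : X ⟶ M, s ≫ g = 𝟙 X}
  add_mem' := by
    rintro g g' hg hg' ⟨s, hs⟩
    rw [Preadditive.comp_add] at hs
    rcases hX.retraction_of_add_eq_id homFinite hs with ⟨b, hb⟩ | ⟨b, hb⟩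
    · exact hg ⟨b ≫ s, by simpa using hb⟩
    · exact hg' ⟨b ≫ s, by simpa using hb⟩
  zero_mem' := by
    rintro ⟨s, hs⟩
    rw [comp_zero] at hs
    exact hX.1 ((IsZero.iff_id_eq_zero X).2 hs.symm)
  smul_mem' := by
    rintro c g hg ⟨s, hs⟩
    exact hg ⟨c • s, by simpa using hs⟩

lemma mem_nonRetractions {homFinite : ∀ X Y : C, FiniteDimensional k (X ⟶ Y)}
    {M X : C} {hX : Indec X} {g : M ⟶ X} :
    g ∈ nonRetractions homFinite M hX ↔ ¬ ∃ s : X ⟶ M, s ≫ g = 𝟙 X := Iff.rfl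

lemma comp_pow_eq_pow_comp {D : Type*} [Category* D] {A E : D} {i : A ⟶ E} {α : End A} {β : End E}
    (h : i ≫ β = α ≫ i) (n : ℕ) : i ≫ (β ^ n : End E) = (α ^ n : End A) ≫ i := by
  induction n with
  | zero => rw [pow_zero, pow_zero, End.one_def, End.one_def, Category.comp_id, Category.id_comp]
  | succ n ih =>
    rw [pow_succ, pow_succ, End.mul_def, End.mul_def, ← Category.assoc, h, Category.assoc, ih,
      Category.assoc]

lemma pow_comp_eq {D : Type*} [Category* D] {E B : D} {p : E ⟶ B} {β : End E}
    (h : β ≫ p = p) (n : ℕ) : (β ^ n : End E) ≫ p = p := by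
  induction n with
  | zero => rw [pow_zero, End.one_def, Category.id_comp]
  | succ n ih => rw [pow_succ, End.mul_def, Category.assoc, ih, h]

end Indecomposable

section Extensions

variable {T : YonedaExt k C}

lemma pull_comp_apply (T : YonedaExt k C) {X'' X' X Y : C} (f : X'' ⟶ X') (g : X' ⟶ X)
    (ν : T.ext X Y) : T.pull (f ≫ g) Y ν = T.pull f Y (T.pull g Y ν) := by
  rw [T.pull_comp]; rfl

lemma push_comp_apply (T : YonedaExt k C) {X Y Y' Y'' : C} (f : Y ⟶ Y') (g : Y' ⟶ Y'')
    (ν : T.ext X Y) : T.push X (f ≫ g) ν = T.push X g (T.push X f ν) := by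
  rw [T.push_comp]; rfl

lemma push_pull_apply (T : YonedaExt k C) {X' X Y Y' : C} (f : X' ⟶ X) (g : Y ⟶ Y')
    (ν : T.ext X Y) : T.push X' g (T.pull f Y ν) = T.pull f Y' (T.push X g ν) :=
  LinearMap.congr_fun (T.pull_push f g) ν

lemma pull_id_apply (T : YonedaExt k C) {X Y : C} (ν : T.ext X Y) : T.pull (𝟙 X) Y ν = ν := by
  rw [T.pull_id]; rfl

lemma push_id_apply (T : YonedaExt k C) {X Y : C} (ν : T.ext X Y) : T.push X (𝟙 Y) ν = ν := by
  rw [T.push_id]; rfl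

variable {A E B : C} {i : A ⟶ E} {p : E ⟶ B} {w : i ≫ p = 0}

lemma exists_lift (hS : (ShortComplex.mk i p w).ShortExact) {W : C} (f : W ⟶ E)
    (hf : f ≫ p = 0) : ∃ t : W ⟶ A, t ≫ i = f :=
  have := hS.mono_f
  ⟨hS.exact.lift f hf, hS.exact.lift_f f hf⟩

lemma exists_desc (hS : (ShortComplex.mk i p w).ShortExact) {W : C} (f : E ⟶ W)
    (hf : i ≫ f = 0) : ∃ t : B ⟶ W, p ≫ t = f :=
  have := hS.epi_g
  ⟨hS.exact.desc f hf, hS.exact.g_desc f hf⟩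

lemma cls_eq_zero_of_retraction (hS : (ShortComplex.mk i p w).ShortExact) {r : E ⟶ A}
    (hr : i ≫ r = 𝟙 A) : T.cls hS = 0 :=
  (T.cls_eq_zero_iff hS).2 ⟨.ofExactOfRetraction _ hS.exact r hr hS.epi_g⟩

lemma cls_eq_zero_of_section (hS : (ShortComplex.mk i p w).ShortExact) {s : B ⟶ E}
    (hs : s ≫ p = 𝟙 B) : T.cls hS = 0 :=
  (T.cls_eq_zero_iff hS).2 ⟨.ofExactOfSection _ hS.exact s hs hS.mono_f⟩

/-- The pullback of an extension along `h` vanishes iff `h` lifts to the middle term. -/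
lemma pull_cls_eq_zero_iff (hS : (ShortComplex.mk i p w).ShortExact) {W : C} (h : W ⟶ B) :
    T.pull h A (T.cls hS) = 0 ↔ ∃ l : W ⟶ E, l ≫ p = h := by
  obtain ⟨E', i', p', w', hS', m, hcls, him, hmp⟩ := T.cls_pull hS h
  dsimp only at *
  rw [← hcls]
  constructor
  · intro h0
    obtain ⟨σ⟩ := (T.cls_eq_zero_iff hS').1 h0
    refine ⟨σ.s ≫ m, ?_⟩
    rw [Category.assoc, hmp]
    exact σ.s_g_assoc _
  · rintro ⟨l, hl⟩
    obtain ⟨t, ht⟩ := exists_lift hS (m - p' ≫ l) (by simp [hmp, hl])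
    have := hS.mono_f
    refine cls_eq_zero_of_retraction hS' (r := t) ?_
    rw [← cancel_mono i, Category.assoc, ht, Preadditive.comp_sub, him, reassoc_of% w']
    simp

/-- The pushout of an extension along `f` vanishes iff `f` extends to the middle term. -/
lemma push_cls_eq_zero_iff (hS : (ShortComplex.mk i p w).ShortExact) {W : C} (f : A ⟶ W) :
    T.push B f (T.cls hS) = 0 ↔ ∃ l : E ⟶ W, i ≫ l = f := by
  obtain ⟨E', i', p', w', hS', m, hcls, him, hmp⟩ := T.cls_push hS f
  dsimp only at *
  rw [← hcls]
  constructor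
  · intro h0
    obtain ⟨σ⟩ := (T.cls_eq_zero_iff hS').1 h0
    refine ⟨m ≫ σ.r, ?_⟩
    rw [reassoc_of% him]
    have := σ.f_r
    dsimp at this
    rw [this, Category.comp_id]
  · rintro ⟨l, hl⟩
    obtain ⟨t, ht⟩ := exists_desc hS (m - l ≫ i') (by simp [him, reassoc_of% hl])
    have := hS.epi_g
    refine cls_eq_zero_of_section hS' (s := t) ?_
    rw [← cancel_epi p, reassoc_of% ht, Preadditive.sub_comp, hmp, Category.assoc, w']
    simp

/-- An extension killed by pushout along every non-section. -/
def KilledByNonSections (T : YonedaExt k C) {X Y : C} (ν : T.ext X Y) : Prop :=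
  ∀ (W : C) (f : Y ⟶ W), (¬ ∃ r : W ⟶ Y, f ≫ r = 𝟙 Y) → T.push X f ν = 0

/-- An extension killed by pullback along every non-retraction. -/
def KilledByNonRetractions (T : YonedaExt k C) {X Y : C} (ν : T.ext X Y) : Prop :=
  ∀ (W : C) (h : W ⟶ X), (¬ ∃ s : X ⟶ W, s ≫ h = 𝟙 X) → T.pull h Y ν = 0

lemma killedByNonSections_cls (hS : (ShortComplex.mk i p w).ShortExact)
    (hi : IsLeftAlmostSplit i) : KilledByNonSections T (T.cls hS) := fun W f hf =>
  (push_cls_eq_zero_iff hS f).2 (hi.2 W f hf)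

lemma killedByNonRetractions_cls (hS : (ShortComplex.mk i p w).ShortExact)
    (hp : IsRightAlmostSplit p) : KilledByNonRetractions T (T.cls hS) := fun W h hh =>
  (pull_cls_eq_zero_iff hS h).2 (hp.2 W h hh)

/-- Every nonzero extension by the source of a left almost split monomorphism pulls back to
a nonzero extension killed by the non-sections. -/
lemma exists_pull_killedByNonSections (hS : (ShortComplex.mk i p w).ShortExact)
    (hi : IsLeftAlmostSplit i) {M : C} {ν : T.ext M A} (hν : ν ≠ 0) :
    ∃ g : B ⟶ M, T.pull g A ν ≠ 0 ∧ KilledByNonSections T (T.pull g A ν) := by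
  obtain ⟨F, j, q, w', hS', rfl⟩ := T.cls_surjective _ _ ν
  obtain ⟨a, ha⟩ := hi.2 F j fun ⟨r, hr⟩ => hν (cls_eq_zero_of_retraction hS' hr)
  obtain ⟨g, hg⟩ := exists_desc hS (a ≫ q) (by rw [reassoc_of% ha, w'])
  refine ⟨g, fun h0 => ?_, fun W f hf => ?_⟩
  · obtain ⟨l, hl⟩ := (pull_cls_eq_zero_iff hS' g).1 h0
    obtain ⟨t, ht⟩ := exists_lift hS' (a - p ≫ l) (by simp [hl, hg])
    have := hS'.mono_f
    refine hi.1 ⟨t, ?_⟩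
    rw [← cancel_mono j, Category.assoc, ht, Preadditive.comp_sub, ha, reassoc_of% w]
    simp
  · obtain ⟨h, hh⟩ := hi.2 W f hf
    obtain ⟨G, j', q', w'', hG, n, hcls, hjn, hnq⟩ := T.cls_push hS' f
    dsimp only at *
    rw [push_pull_apply, ← hcls]
    refine (pull_cls_eq_zero_iff hG g).2 ?_
    obtain ⟨l, hl⟩ := exists_desc hS (a ≫ n - h ≫ j')
      (by rw [Preadditive.comp_sub, reassoc_of% ha, hjn, reassoc_of% hh, sub_self])
    have := hS.epi_g
    refine ⟨l, ?_⟩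
    rw [← cancel_epi p, reassoc_of% hl, Preadditive.sub_comp, Category.assoc, Category.assoc,
      hnq, w'', hg]
    simp

/-- Every nonzero extension of the target of a right almost split epimorphism pushes out to
a nonzero extension killed by the non-retractions. -/
lemma exists_push_killedByNonRetractions (hS : (ShortComplex.mk i p w).ShortExact)
    (hp : IsRightAlmostSplit p) {M : C} {ν : T.ext B M} (hν : ν ≠ 0) :
    ∃ f : M ⟶ A, T.push B f ν ≠ 0 ∧ KilledByNonRetractions T (T.push B f ν) := by
  obtain ⟨F, j, q, w', hS', rfl⟩ := T.cls_surjective _ _ ν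
  obtain ⟨a, ha⟩ := hp.2 F q fun ⟨s, hs⟩ => hν (cls_eq_zero_of_section hS' hs)
  obtain ⟨f, hf⟩ := exists_lift hS (j ≫ a) (by rw [Category.assoc, ha, w'])
  refine ⟨f, fun h0 => ?_, fun W h hh => ?_⟩
  · obtain ⟨l, hl⟩ := (push_cls_eq_zero_iff hS' f).1 h0
    obtain ⟨t, ht⟩ := exists_desc hS' (a - l ≫ i) (by simp [reassoc_of% hl, hf])
    have := hS'.epi_g
    refine hp.1 ⟨t, ?_⟩
    rw [← cancel_epi q, reassoc_of% ht, Preadditive.sub_comp, ha, Category.assoc, w]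
    simp
  · obtain ⟨g, hg⟩ := hp.2 W h hh
    obtain ⟨G, j', q', w'', hG, n, hcls, hjn, hnq⟩ := T.cls_pull hS' h
    dsimp only at *
    rw [← push_pull_apply, ← hcls]
    refine (push_cls_eq_zero_iff hG f).2 ?_
    obtain ⟨l, hl⟩ := exists_lift hS (n ≫ a - q' ≫ g)
      (by rw [Preadditive.sub_comp, Category.assoc, Category.assoc, ha, hnq, hg, sub_self])
    have := hS.mono_f
    refine ⟨l, ?_⟩
    rw [← cancel_mono i, Category.assoc, hl, Preadditive.comp_sub, reassoc_of% hjn,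
      reassoc_of% w'', hf]
    simp

/-- The extension classes killed by the non-sections form a single orbit under pullback. -/
lemma exists_pull_eq_cls (hS : (ShortComplex.mk i p w).ShortExact)
    (hi : IsLeftAlmostSplit i) (hp : IsRightAlmostSplit p)
    {ν : T.ext B A} (hν : ν ≠ 0) (hk : KilledByNonSections T ν) :
    ∃ y : B ⟶ B, T.pull y A ν = T.cls hS := by
  obtain ⟨F, j, q, w', hF, he⟩ := T.cls_surjective (B ⊞ B) A
    (T.pull biprod.fst A (T.cls hS) + T.pull biprod.snd A ν)
  have hinr : T.pull biprod.inr A (T.cls hF) = ν := by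
    rw [he, map_add, ← pull_comp_apply, ← pull_comp_apply, biprod.inr_fst, biprod.inr_snd,
      T.pull_zero, pull_id_apply, LinearMap.zero_apply, zero_add]
  by_cases hret : ∃ s : B ⟶ F, s ≫ q ≫ biprod.fst = 𝟙 B
  · obtain ⟨s, hs⟩ := hret
    have h0 := (pull_cls_eq_zero_iff (T := T) hF (s ≫ q)).2 ⟨s, rfl⟩
    rw [he, map_add, ← pull_comp_apply, ← pull_comp_apply, Category.assoc, hs,
      pull_id_apply] at h0
    refine ⟨-((s ≫ q) ≫ biprod.snd), ?_⟩
    rw [← neg_one_smul k, T.pull_smul, LinearMap.smul_apply, neg_one_smul]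
    exact (eq_neg_of_add_eq_zero_left h0).symm
  exfalso
  obtain ⟨a, ha⟩ := hp.2 F _ hret
  obtain ⟨c, hc⟩ := exists_lift hS (j ≫ a) (by rw [Category.assoc, ha, reassoc_of% w', zero_comp])
  by_cases hsec : ∃ r : A ⟶ A, c ≫ r = 𝟙 A
  · obtain ⟨r, hr⟩ := hsec
    obtain ⟨G, j', q', w'', hG, n, hcls, hjn, hnq⟩ := T.cls_pull hF (biprod.inr : B ⟶ B ⊞ B)
    dsimp only at *
    obtain ⟨t, ht⟩ := exists_lift hS (n ≫ a) (by
      rw [Category.assoc, ha, reassoc_of% hnq, biprod.inr_fst, comp_zero])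
    have := hS.mono_f
    have hjt : j' ≫ t = c := by
      rw [← cancel_mono i, Category.assoc, ht, reassoc_of% hjn, hc]
    refine hν ?_
    rw [← hinr, ← hcls]
    exact cls_eq_zero_of_retraction hG (r := t ≫ r) (by rw [reassoc_of% hjt, hr])
  · obtain ⟨d, hd⟩ := (push_cls_eq_zero_iff (T := T) hF c).1 (by
      rw [he, map_add, push_pull_apply, push_pull_apply, hk _ c hsec,
        killedByNonSections_cls hS hi _ c hsec, map_zero, map_zero, add_zero])
    obtain ⟨t, ht⟩ := exists_desc hF (a - d ≫ i) (by
      rw [Preadditive.comp_sub, reassoc_of% hd, hc, sub_self])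
    have := hF.epi_g
    refine hp.1 ⟨biprod.inl ≫ t, ?_⟩
    have htp : t ≫ p = biprod.fst := by
      rw [← cancel_epi q, reassoc_of% ht, Preadditive.sub_comp, ha, Category.assoc, w]
      simp
    rw [Category.assoc, htp, biprod.inl_fst]

/-- The extension classes killed by the non-retractions form a single orbit under pushout. -/
lemma exists_push_eq_cls (hS : (ShortComplex.mk i p w).ShortExact)
    (hi : IsLeftAlmostSplit i) (hp : IsRightAlmostSplit p)
    {ν : T.ext B A} (hν : ν ≠ 0) (hk : KilledByNonRetractions T ν) :
    ∃ y : A ⟶ A, T.push B y ν = T.cls hS := by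
  obtain ⟨F, j, q, w', hF, he⟩ := T.cls_surjective B (A ⊞ A)
    (T.push B biprod.inl (T.cls hS) + T.push B biprod.inr ν)
  have hsnd : T.push B biprod.snd (T.cls hF) = ν := by
    rw [he, map_add, ← push_comp_apply, ← push_comp_apply, biprod.inl_snd, biprod.inr_snd,
      T.push_zero, push_id_apply, LinearMap.zero_apply, zero_add]
  by_cases hsec : ∃ r : F ⟶ A, (biprod.inl ≫ j) ≫ r = 𝟙 A
  · obtain ⟨r, hr⟩ := hsec
    have h0 := (push_cls_eq_zero_iff (T := T) hF (j ≫ r)).2 ⟨r, rfl⟩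
    rw [he, map_add, ← push_comp_apply, ← push_comp_apply, ← Category.assoc, hr,
      push_id_apply] at h0
    refine ⟨-(biprod.inr ≫ j ≫ r), ?_⟩
    rw [← neg_one_smul k, T.push_smul, LinearMap.smul_apply, neg_one_smul]
    exact (eq_neg_of_add_eq_zero_left h0).symm
  exfalso
  obtain ⟨a, ha⟩ := hi.2 F _ hsec
  obtain ⟨c, hc⟩ := exists_desc hS (a ≫ q) (by
    rw [reassoc_of% ha, w', comp_zero])
  by_cases hret : ∃ s : B ⟶ B, s ≫ c = 𝟙 B
  · obtain ⟨s, hs⟩ := hret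
    obtain ⟨G, j', q', w'', hG, n, hcls, hjn, hnq⟩ := T.cls_push hF (biprod.snd : A ⊞ A ⟶ A)
    dsimp only at *
    obtain ⟨t, ht⟩ := exists_desc hS (a ≫ n) (by
      rw [reassoc_of% ha, hjn, biprod.inl_snd_assoc, zero_comp])
    have := hS.epi_g
    have htq : t ≫ q' = c := by
      rw [← cancel_epi p, reassoc_of% ht, hnq, hc]
    refine hν ?_
    rw [← hsnd, ← hcls]
    exact cls_eq_zero_of_section hG (s := s ≫ t) (by rw [Category.assoc, htq, hs])
  · obtain ⟨d, hd⟩ := (pull_cls_eq_zero_iff (T := T) hF c).1 (by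
      rw [he, map_add, ← push_pull_apply, ← push_pull_apply, hk _ c hret,
        killedByNonRetractions_cls hS hp _ c hret, map_zero, map_zero, add_zero])
    obtain ⟨t, ht⟩ := exists_lift hF (a - p ≫ d) (by
      rw [Preadditive.sub_comp, Category.assoc, hd, hc, sub_self])
    have := hF.mono_f
    refine hi.1 ⟨t ≫ biprod.fst, ?_⟩
    have hit : i ≫ t = biprod.inl := by
      rw [← cancel_mono j, Category.assoc, ht, Preadditive.comp_sub, ha, reassoc_of% w]
      simp
    rw [reassoc_of% hit, biprod.inl_fst]

/-- In an extension of objects with the first one indecomposable, the inclusion is left almost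
split if the projection is right almost split. -/
lemma isLeftAlmostSplit_of_isRightAlmostSplit
    (homFinite : ∀ X Y : C, FiniteDimensional k (X ⟶ Y)) (T : YonedaExt k C)
    (hS : (ShortComplex.mk i p w).ShortExact) (hA : Indec A) (hp : IsRightAlmostSplit p) :
    IsLeftAlmostSplit i := by
  have hcls : T.cls hS ≠ 0 := fun h0 => by
    obtain ⟨σ⟩ := (T.cls_eq_zero_iff hS).1 h0
    exact hp.1 ⟨σ.s, σ.s_g⟩
  refine ⟨fun ⟨r, hr⟩ => hcls (cls_eq_zero_of_retraction hS hr), fun W f hf => ?_⟩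
  by_contra hext
  rw [← push_cls_eq_zero_iff (T := T) hS] at hext
  obtain ⟨E', i', p', w', hS', m, hcls', him, hmp⟩ := T.cls_push hS f
  dsimp only at *
  rw [← hcls'] at hext
  obtain ⟨b, hb⟩ := hp.2 E' p' fun ⟨s, hs⟩ => hext (cls_eq_zero_of_section hS' hs)
  obtain ⟨d, hd⟩ := exists_lift hS (i' ≫ b) (by rw [Category.assoc, hb, w'])
  have hmb : i ≫ m ≫ b = (f ≫ d) ≫ i := by rw [reassoc_of% him, Category.assoc, hd]
  have hmbp : (m ≫ b) ≫ p = p := by rw [Category.assoc, hb, hmp]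
  rcases hA.isNilpotent_or_isUnit homFinite (End.of (f ≫ d)) with ⟨n, hn⟩ | h
  · have h1 := comp_pow_eq_pow_comp (α := End.of (f ≫ d)) (β := End.of (m ≫ b)) hmb n
    have h2 := pow_comp_eq (β := End.of (m ≫ b)) hmbp n
    rw [hn] at h1
    obtain ⟨t, ht⟩ := exists_desc hS _ (h1.trans zero_comp)
    have := hS.epi_g
    refine hp.1 ⟨t, ?_⟩
    rw [← cancel_epi p, reassoc_of% ht, h2, Category.comp_id]
  · obtain ⟨-, r, hr⟩ := exists_comp_eq_id_of_isUnit h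
    exact hf ⟨d ≫ r, (Category.assoc f d r).symm.trans hr⟩

end Extensions

section Representability

variable {T : YonedaExt k C}

lemma comp_mem_PTriv_left {X Y Z : C} {f : X ⟶ Y} (hf : f ∈ PTriv T X Y) (g : Y ⟶ Z) :
    f ≫ g ∈ PTriv T X Z := fun W => by rw [T.pull_comp, hf W, LinearMap.zero_comp]

lemma comp_mem_PTriv_right {X Y Z : C} (f : X ⟶ Y) {g : Y ⟶ Z} (hg : g ∈ PTriv T Y Z) :
    f ≫ g ∈ PTriv T X Z := fun W => by rw [T.pull_comp, hg W, LinearMap.comp_zero]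

/-- An object which is not projective has an indecomposable summand which is not projective. -/
lemma exists_indec_summand (homFinite : ∀ X Y : C, FiniteDimensional k (X ⟶ Y))
    {P : C} (hP : 𝟙 P ∉ PTriv T P P) :
    ∃ X : C, Indec X ∧ 𝟙 X ∉ PTriv T X X ∧ IsDirectSummand X P := by
  suffices h : ∀ (n : ℕ) (X : C), Module.finrank k (X ⟶ X) = n → 𝟙 X ∉ PTriv T X X →
      IsDirectSummand X P → ∃ X : C, Indec X ∧ 𝟙 X ∉ PTriv T X X ∧ IsDirectSummand X P from
    h _ P rfl hP ⟨𝟙 P, 𝟙 P, Category.id_comp _⟩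
  intro n
  induction n using Nat.strong_induction_on with
  | _ n ih =>
  intro X hn hX hXP
  obtain ⟨ι, ρ, hιρ⟩ := hXP
  by_cases hind : Indec X
  · exact ⟨X, hind, hX, ι, ρ, hιρ⟩
  have hX0 : ¬ IsZero X := fun h0 => hX (by
    rw [(IsZero.iff_id_eq_zero X).1 h0]; exact Submodule.zero_mem _)
  obtain ⟨A, B, ⟨φ⟩, hA0, hB0⟩ : ∃ A B : C, Nonempty (X ≅ A ⊞ B) ∧ ¬ IsZero A ∧ ¬ IsZero B := by
    by_contra! hcon
    exact hind ⟨hX0, fun A B h => or_iff_not_imp_left.2 (hcon A B h)⟩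
  have step : ∀ (A B : C) (a : A ⟶ X) (a' : X ⟶ A) (b : B ⟶ X) (b' : X ⟶ B),
      a ≫ a' = 𝟙 A → b ≫ b' = 𝟙 B → a ≫ b' = 0 → b ≫ a' = 0 → ¬ IsZero B →
      𝟙 A ∉ PTriv T A A → ∃ X : C, Indec X ∧ 𝟙 X ∉ PTriv T X X ∧ IsDirectSummand X P := by
    intro A B a a' b b' haa hbb hab hba hB hA
    refine ih _ ?_ A rfl hA ⟨a ≫ ι, ρ ≫ a', by rw [Category.assoc, reassoc_of% hιρ, haa]⟩
    have := homFinite X X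
    have := homFinite A A
    have := homFinite B B
    let L : ((A ⟶ A) × (B ⟶ B)) →ₗ[k] (X ⟶ X) :=
      { toFun := fun x => a' ≫ x.1 ≫ a + b' ≫ x.2 ≫ b
        map_add' := fun x y => by simp; abel
        map_smul' := fun c x => by simp }
    have hL : Function.Injective L := by
      rw [← LinearMap.ker_eq_bot, LinearMap.ker_eq_bot']
      rintro ⟨x, y⟩ hxy
      have hxy' : a' ≫ x ≫ a + b' ≫ y ≫ b = 0 := hxy
      have h1 : a ≫ (a' ≫ x ≫ a + b' ≫ y ≫ b) ≫ a' = x := by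
        simp [reassoc_of% haa, haa, reassoc_of% hab]
      have h2 : b ≫ (a' ≫ x ≫ a + b' ≫ y ≫ b) ≫ b' = y := by
        simp [reassoc_of% hbb, hbb, reassoc_of% hba]
      rw [hxy'] at h1 h2
      ext <;> simp [← h1, ← h2]
    have hle := LinearMap.finrank_le_finrank_of_injective hL
    rw [Module.finrank_prod] at hle
    have : Nontrivial (B ⟶ B) := ⟨𝟙 B, 0, fun h => hB ((IsZero.iff_id_eq_zero B).2 h)⟩
    have hpos : 0 < Module.finrank k (B ⟶ B) := Module.finrank_pos
    omega
  by_cases hA : 𝟙 A ∈ PTriv T A A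
  · by_cases hB : 𝟙 B ∈ PTriv T B B
    · refine absurd ?_ hX
      have h1 := comp_mem_PTriv_right (φ.hom ≫ biprod.fst)
        (comp_mem_PTriv_left hA (biprod.inl ≫ φ.inv))
      have h2 := comp_mem_PTriv_right (φ.hom ≫ biprod.snd)
        (comp_mem_PTriv_left hB (biprod.inr ≫ φ.inv))
      have h3 : 𝟙 X = (φ.hom ≫ biprod.fst) ≫ 𝟙 A ≫ biprod.inl ≫ φ.inv +
          (φ.hom ≫ biprod.snd) ≫ 𝟙 B ≫ biprod.inr ≫ φ.inv := by
        calc 𝟙 X = φ.hom ≫ (biprod.fst ≫ biprod.inl + biprod.snd ≫ biprod.inr) ≫ φ.inv := by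
              rw [biprod.total]; simp
          _ = _ := by
              simp only [Preadditive.add_comp, Preadditive.comp_add, Category.assoc,
                Category.id_comp]
      rw [h3]
      exact Submodule.add_mem _ h1 h2
    · exact step B A (biprod.inr ≫ φ.inv) (φ.hom ≫ biprod.snd) (biprod.inl ≫ φ.inv)
        (φ.hom ≫ biprod.fst) (by simp) (by simp) (by simp) (by simp) hA0 hB
  · exact step A B (biprod.inl ≫ φ.inv) (φ.hom ≫ biprod.fst) (biprod.inr ≫ φ.inv)
        (φ.hom ≫ biprod.snd) (by simp) (by simp) (by simp) (by simp) hB0 hA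

lemma RepresentsL.id_notMem_PTriv {Y Xt : C} (hrep : RepresentsL T Y Xt)
    (hni : ¬ IsInjObj T Y) : 𝟙 Xt ∉ PTriv T Xt Xt := by
  obtain ⟨e, -⟩ := hrep
  intro hid
  refine hni fun Z ν => (Module.forall_dual_apply_eq_zero_iff k ν).1 fun φ => ?_
  obtain ⟨x, rfl⟩ := (e Z).surjective φ
  obtain ⟨g, rfl⟩ := Submodule.Quotient.mk_surjective _ x
  have hg : g ∈ PTriv T Xt Z := by simpa using comp_mem_PTriv_left hid g
  rw [(Submodule.Quotient.mk_eq_zero _).2 hg, map_zero, LinearMap.zero_apply]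

lemma RepresentsL.exists_almostSplit (homFinite : ∀ X Y : C, FiniteDimensional k (X ⟶ Y))
    {Y Xt : C} (hrep : RepresentsL T Y Xt) (hind : Indec Y) (hni : ¬ IsInjObj T Y) :
    ∃ (E Z : C) (u : Y ⟶ E) (v : E ⟶ Z) (w : u ≫ v = 0), IsAlmostSplitConflation u v w := by
  obtain ⟨X, hX, hXP, ι, ρ, hιρ⟩ :=
    exists_indec_summand homFinite (hrep.id_notMem_PTriv hni)
  obtain ⟨e, he⟩ := hrep
  have := homFinite Xt X
  have hle : PTriv T Xt X ≤ nonRetractions homFinite Xt hX := by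
    intro g hg
    rw [mem_nonRetractions]
    rintro ⟨s, hs⟩
    exact hXP (hs ▸ comp_mem_PTriv_right s hg)
  have hρ : (PTriv T Xt X).mkQ ρ ∉ (nonRetractions homFinite Xt hX).map (PTriv T Xt X).mkQ := by
    rw [← Submodule.mem_comap, Submodule.comap_map_mkQ, sup_eq_right.2 hle]
    exact fun h => mem_nonRetractions.1 h ⟨ι, hιρ⟩
  obtain ⟨μ, hμ, hμN⟩ := exists_orthogonal_of_notMem (e X) hρ
  have hkill : KilledByNonRetractions T μ := by
    intro W h hh
    refine (Module.forall_dual_apply_eq_zero_iff k _).1 fun φ => ?_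
    obtain ⟨x, rfl⟩ := (e W).surjective φ
    obtain ⟨g, rfl⟩ := Submodule.Quotient.mk_surjective _ x
    rw [← he]
    exact hμN _ ⟨g ≫ h, mem_nonRetractions.2 fun ⟨s, hs⟩ =>
      hh ⟨s ≫ g, by rw [Category.assoc, hs]⟩, rfl⟩
  obtain ⟨E, u, v, w, hS, rfl⟩ := T.cls_surjective _ _ μ
  have hv : IsRightAlmostSplit v :=
    ⟨fun ⟨s, hs⟩ => hμ (by rw [cls_eq_zero_of_section hS hs, map_zero]),
      fun W h hh => (pull_cls_eq_zero_iff hS h).1 (hkill W h hh)⟩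
  exact ⟨E, X, u, v, w, hS, isLeftAlmostSplit_of_isRightAlmostSplit homFinite T hS hind hv, hv⟩

/-- The bilinear pairing between `C̲(Z, M)` and `Ext(M, Y)` induced by a linear form on
`Ext(Z, Y)`. -/
def stablePairing (T : YonedaExt k C) {Z Y : C} (θ : Module.Dual k (T.ext Z Y)) (M : C) :
    HomUnder T Z M →ₗ[k] Module.Dual k (T.ext M Y) :=
  (PTriv T Z M).liftQ
    { toFun := fun g => θ ∘ₗ T.pull g Y
      map_add' := fun f g => by rw [T.pull_add, LinearMap.comp_add]
      map_smul' := fun c g => by rw [T.pull_smul, LinearMap.comp_smul]; rfl }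
    (fun g hg => by
      rw [LinearMap.mem_ker, LinearMap.coe_mk, AddHom.coe_mk, hg Y, LinearMap.comp_zero])

lemma stablePairing_mk (T : YonedaExt k C) {Z Y : C} (θ : Module.Dual k (T.ext Z Y)) {M : C}
    (g : Z ⟶ M) (ν : T.ext M Y) :
    stablePairing T θ M (Submodule.Quotient.mk g) ν = θ (T.pull g Y ν) := rfl

lemma IsAlmostSplitConflation.representsL
    (homFinite : ∀ X Y : C, FiniteDimensional k (X ⟶ Y)) (T : YonedaExt k C)
    {Y E Z : C} {u : Y ⟶ E} {v : E ⟶ Z} {w : u ≫ v = 0} (h : IsAlmostSplitConflation u v w) :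
    RepresentsL T Y Z := by
  obtain ⟨hS, hu, hv⟩ := h
  have hcls : T.cls hS ≠ 0 := fun h0 => by
    obtain ⟨σ⟩ := (T.cls_eq_zero_iff hS).1 h0
    exact hv.1 ⟨σ.s, σ.s_g⟩
  obtain ⟨θ, hθ⟩ : ∃ θ : Module.Dual k (T.ext Z Y), θ (T.cls hS) ≠ 0 := by
    by_contra! hcon
    exact hcls ((Module.forall_dual_apply_eq_zero_iff k _).1 hcon)
  have hbij : ∀ M, Function.Bijective (stablePairing T θ M) := by
    intro M
    have := homFinite Z M
    refine (LinearMap.IsPerfPair.of_injective (p := stablePairing T θ M) ?_ ?_).bijective_left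
    · rw [← LinearMap.ker_eq_bot, LinearMap.ker_eq_bot']
      intro x hx
      obtain ⟨g, rfl⟩ := Submodule.Quotient.mk_surjective _ x
      rw [Submodule.Quotient.mk_eq_zero]
      by_contra hg
      obtain ⟨W, ν, hν⟩ : ∃ (W : C) (ν : T.ext M W), T.pull g W ν ≠ 0 := by
        by_contra! hcon
        exact hg fun W => LinearMap.ext (hcon W)
      obtain ⟨f, hf0, hf⟩ := exists_push_killedByNonRetractions hS hv hν
      obtain ⟨y, hy⟩ := exists_push_eq_cls hS hu hv hf0 hf
      rw [push_pull_apply, push_pull_apply] at hy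
      refine hθ ?_
      rw [← hy, ← stablePairing_mk, hx, LinearMap.zero_apply]
    · rw [← LinearMap.ker_eq_bot, LinearMap.ker_eq_bot']
      intro ν hν
      by_contra hν0
      obtain ⟨g, hg0, hg⟩ := exists_pull_killedByNonSections hS hu hν0
      obtain ⟨y, hy⟩ := exists_pull_eq_cls hS hu hv hg0 hg
      rw [← pull_comp_apply] at hy
      refine hθ ?_
      rw [← hy, ← stablePairing_mk, ← LinearMap.flip_apply, hν, LinearMap.zero_apply]
  refine ⟨fun M => LinearEquiv.ofBijective _ (hbij M), fun M M' h g μ => ?_⟩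
  simp only [LinearEquiv.ofBijective_apply, stablePairing_mk, pull_comp_apply]

end Representability

/-- **Proposition 2.4(2)**.  A non-injective indecomposable object `Y` lies in `C_l` if and
only if there exists an almost split conflation starting at `Y`. -/
theorem prop_Cl
    (homFinite : ∀ X Y : C, FiniteDimensional k (X ⟶ Y))
    (T : YonedaExt k C)
    (Y : C) (hind : Indec Y) (hni : ¬ IsInjObj T Y) :
    MemCl T Y ↔
      ∃ (E Z : C) (u : Y ⟶ E) (v : E ⟶ Z) (w : u ≫ v = 0),
        IsAlmostSplitConflation u v w := by
  constructor
  · rintro ⟨Xt, hrep⟩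
    exact hrep.exists_almostSplit homFinite hind hni
  · rintro ⟨E, Z, u, v, w, h⟩
    exact ⟨Z, h.representsL homFinite T⟩

end GenAR
end

section
/- Let Y be an object of C. (1) If Y ∈ C_r, then τY ∈ C_l and τ⁻τY ≅ Y in the projectively stable category C̲. (2) If Y ∈ C_l, then τ⁻Y ∈ C_r and ττ⁻Y ≅ Y in the injectively stable category C̄. -/
/-!
Common setup: a Hom-finite Krull-Schmidt `k`-linear abelian category `C`, regarded as an exact
category whose conflations are all short exact sequences.  The Yoneda Ext¹-bifunctor of this
exact structure, together with the assignment of its extension class to each short exact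
sequence and the standard pullback/pushout functorialities, is axiomatized by the structure
`YonedaExt` below.  (Over a field, Hom-finiteness together with the existence of an abelian
structure makes `C` Krull-Schmidt automatically.)
-/

open CategoryTheory CategoryTheory.Limits

universe v u

namespace GenAR

variable {k : Type} [Field k] {C : Type u} [Category.{v} C] [Abelian C] [Linear k C]

namespace YonedaExt

variable (T : YonedaExt k C)

/-- A morphism kills the class of a short exact sequence under pushout iff it extends along
the inflation. -/
lemma push_cls_eq_zero_iff {S : ShortComplex C} (hS : S.ShortExact) {Z : C} (g : S.X₁ ⟶ Z) :
    T.push S.X₃ g (T.cls hS) = 0 ↔ ∃ t : S.X₂ ⟶ Z, S.f ≫ t = g := by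
  obtain ⟨E', i', p', w', hS', m, hcls, hm, hp⟩ := T.cls_push hS g
  rw [← hcls, T.cls_eq_zero_iff hS']
  constructor
  · rintro ⟨s⟩
    have hr : i' ≫ s.r = 𝟙 Z := s.f_r
    exact ⟨m ≫ s.r, by rw [← Category.assoc, hm, Category.assoc, hr, Category.comp_id]⟩
  · rintro ⟨t, rfl⟩
    have := hS.epi_g
    have h0 : S.f ≫ (m - t ≫ i') = 0 := by
      rw [Preadditive.comp_sub, hm, Category.assoc, sub_self]
    have hs : S.g ≫ hS.exact.desc (m - t ≫ i') h0 = m - t ≫ i' := hS.exact.g_desc _ h0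
    refine ⟨ShortComplex.Splitting.ofExactOfSection _ hS'.exact
      (hS.exact.desc (m - t ≫ i') h0) ?_ hS'.mono_f⟩
    rw [← cancel_epi S.g]
    dsimp only
    rw [← Category.assoc, hs, Preadditive.sub_comp, Category.assoc, w', comp_zero, sub_zero, hp]
    exact (Category.comp_id _).symm

/-- A morphism kills the class of a short exact sequence under pullback iff it lifts along
the deflation. -/
lemma pull_cls_eq_zero_iff {S : ShortComplex C} (hS : S.ShortExact) {Z : C} (f : Z ⟶ S.X₃) :
    T.pull f S.X₁ (T.cls hS) = 0 ↔ ∃ t : Z ⟶ S.X₂, t ≫ S.g = f := by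
  obtain ⟨E', i', p', w', hS', m, hcls, hm, hp⟩ := T.cls_pull hS f
  rw [← hcls, T.cls_eq_zero_iff hS']
  constructor
  · rintro ⟨s⟩
    have hs : s.s ≫ p' = 𝟙 Z := s.s_g
    exact ⟨s.s ≫ m, by rw [Category.assoc, hp, ← Category.assoc, hs, Category.id_comp]⟩
  · rintro ⟨t, rfl⟩
    have := hS.mono_f
    have h0 : (m - p' ≫ t) ≫ S.g = 0 := by
      rw [Preadditive.sub_comp, hp, Category.assoc, sub_self]
    have hr : hS.exact.lift (m - p' ≫ t) h0 ≫ S.f = m - p' ≫ t := hS.exact.lift_f _ h0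
    refine ⟨ShortComplex.Splitting.ofExactOfRetraction _ hS'.exact
      (hS.exact.lift (m - p' ≫ t) h0) ?_ hS'.epi_g⟩
    rw [← cancel_mono S.f]
    dsimp only
    rw [Category.assoc, hr, Preadditive.comp_sub, ← Category.assoc, w', zero_comp, sub_zero, hm]
    exact (Category.id_comp _).symm

lemma pull_comp_apply {X'' X' X : C} (f : X'' ⟶ X') (g : X' ⟶ X) (Y : C) (e : T.ext X Y) :
    T.pull (f ≫ g) Y e = T.pull f Y (T.pull g Y e) := by
  rw [T.pull_comp]; rfl

lemma push_comp_apply (X : C) {Y Y' Y'' : C} (g : Y ⟶ Y') (g' : Y' ⟶ Y'') (e : T.ext X Y) :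
    T.push X (g ≫ g') e = T.push X g' (T.push X g e) := by
  rw [T.push_comp]; rfl

lemma pull_push_apply {X' X Y Y' : C} (f : X' ⟶ X) (g : Y ⟶ Y') (e : T.ext X Y) :
    T.push X' g (T.pull f Y e) = T.pull f Y' (T.push X g e) :=
  LinearMap.congr_fun (T.pull_push f g) e

lemma pull_sub {X' X : C} (f g : X' ⟶ X) (Y : C) :
    T.pull (f - g) Y = T.pull f Y - T.pull g Y := by
  rw [eq_sub_iff_add_eq, ← T.pull_add, sub_add_cancel]

lemma push_sub (X : C) {Y Y' : C} (f g : Y ⟶ Y') :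
    T.push X (f - g) = T.push X f - T.push X g := by
  rw [eq_sub_iff_add_eq, ← T.push_add, sub_add_cancel]

/-- Exactness of `Hom(Y, S.X₃) → Ext(Y, S.X₁) → Ext(Y, S.X₂)`. -/
lemma exists_eq_pull_cls {S : ShortComplex C} (hS : S.ShortExact) {Y : C} (ξ : T.ext Y S.X₁)
    (hξ : T.push Y S.f ξ = 0) : ∃ g : Y ⟶ S.X₃, ξ = T.pull g S.X₁ (T.cls hS) := by
  -- Realize `ξ` and the class of `S` simultaneously as one extension of `Y ⊞ S.X₃`.
  obtain ⟨E₂, j, p, w₂, hS₂, hθ⟩ := T.cls_surjective (Y ⊞ S.X₃) S.X₁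
    (T.pull biprod.fst S.X₁ ξ + T.pull biprod.snd S.X₁ (T.cls hS))
  obtain ⟨E', i', p', w', hS', m, hcls, hm, hp⟩ := T.cls_pull hS₂ (biprod.inr : S.X₃ ⟶ Y ⊞ S.X₃)
  dsimp only at i' hS' m hcls hm hp
  have hcls' : T.cls hS' = T.cls hS := by
    rw [hcls, hθ, map_add, ← T.pull_comp_apply, ← T.pull_comp_apply, biprod.inr_fst,
      biprod.inr_snd, T.pull_zero, T.pull_id]
    simp
  have hν : T.push S.X₃ i' (T.cls hS) = 0 := by
    rw [← hcls']
    exact (T.push_cls_eq_zero_iff hS' i').2 ⟨𝟙 _, Category.comp_id _⟩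
  obtain ⟨t', ht'⟩ := (T.push_cls_eq_zero_iff hS i').1 hν
  have hξ' : T.push Y i' ξ = 0 := by
    rw [← ht', T.push_comp_apply, hξ, map_zero]
  have hθ' : T.push (Y ⊞ S.X₃) i' (T.cls hS₂) = 0 := by
    rw [hθ, map_add, T.pull_push_apply, T.pull_push_apply, hξ', hν, map_zero, map_zero, add_zero]
  obtain ⟨t, ht⟩ := (T.push_cls_eq_zero_iff hS₂ i').1 hθ'
  dsimp only at t ht
  have : Epi p := hS₂.epi_g
  obtain ⟨s, hs⟩ : ∃ s : Y ⊞ S.X₃ ⟶ E₂, p ≫ s = t ≫ m - 𝟙 E₂ := by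
    have h0 : j ≫ (t ≫ m - 𝟙 E₂) = 0 := by
      rw [Preadditive.comp_sub, ← Category.assoc, ht, hm, Category.comp_id, sub_self]
    exact ⟨hS₂.exact.desc _ h0, hS₂.exact.g_desc _ h0⟩
  obtain ⟨a, ha⟩ : ∃ a : Y ⊞ S.X₃ ⟶ S.X₃, p ≫ a = t ≫ p' := by
    have h0 : j ≫ t ≫ p' = 0 := by rw [← Category.assoc, ht, w']
    exact ⟨hS₂.exact.desc _ h0, hS₂.exact.g_desc _ h0⟩
  have hsp : s ≫ p = a ≫ biprod.inr - 𝟙 _ := by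
    rw [← cancel_epi p, ← Category.assoc, hs, Preadditive.sub_comp, Category.assoc, hp,
      Preadditive.comp_sub, ← Category.assoc, ← Category.assoc, ha, Category.id_comp,
      Category.comp_id]
  have hlift := (T.pull_cls_eq_zero_iff hS₂ (biprod.inl ≫ a ≫ biprod.inr - biprod.inl)).2
    ⟨biprod.inl ≫ s, by
      rw [Category.assoc]
      dsimp only
      rw [hsp, Preadditive.comp_sub, Category.comp_id]⟩
  refine ⟨biprod.inl ≫ a, ?_⟩
  rw [hθ, map_add] at hlift
  dsimp only at hlift
  rw [← T.pull_comp_apply, ← T.pull_comp_apply, Preadditive.sub_comp,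
    Preadditive.sub_comp, Category.assoc, Category.assoc, Category.assoc, Category.assoc,
    biprod.inr_fst, biprod.inl_fst, biprod.inr_snd, biprod.inl_snd, comp_zero, comp_zero,
    Category.comp_id, sub_zero, T.pull_sub, T.pull_zero, T.pull_id,
    LinearMap.sub_apply, LinearMap.zero_apply, LinearMap.id_apply, zero_sub] at hlift
  exact neg_add_eq_zero.1 hlift

/-- Exactness of `Hom(S.X₁, Y) → Ext(S.X₃, Y) → Ext(S.X₂, Y)`. -/
lemma exists_eq_push_cls {S : ShortComplex C} (hS : S.ShortExact) {Y : C} (ξ : T.ext S.X₃ Y)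
    (hξ : T.pull S.g Y ξ = 0) : ∃ g : S.X₁ ⟶ Y, ξ = T.push S.X₃ g (T.cls hS) := by
  -- Realize `ξ` and the class of `S` simultaneously as one extension by `Y ⊞ S.X₁`.
  obtain ⟨E₂, j, q, w₂, hS₂, hθ⟩ := T.cls_surjective S.X₃ (Y ⊞ S.X₁)
    (T.push S.X₃ biprod.inl ξ + T.push S.X₃ biprod.inr (T.cls hS))
  obtain ⟨E', i', p', w', hS', m, hcls, hm, hp⟩ := T.cls_push hS₂ (biprod.snd : Y ⊞ S.X₁ ⟶ S.X₁)
  dsimp only at p' hS' m hcls hm hp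
  have hcls' : T.cls hS' = T.cls hS := by
    rw [hcls, hθ, map_add, ← T.push_comp_apply, ← T.push_comp_apply, biprod.inl_snd,
      biprod.inr_snd, T.push_zero, T.push_id]
    simp
  have hν : T.pull p' S.X₁ (T.cls hS) = 0 := by
    rw [← hcls']
    exact (T.pull_cls_eq_zero_iff hS' p').2 ⟨𝟙 _, Category.id_comp _⟩
  obtain ⟨t', ht'⟩ := (T.pull_cls_eq_zero_iff hS p').1 hν
  have hξ' : T.pull p' Y ξ = 0 := by
    rw [← ht', T.pull_comp_apply, hξ, map_zero]
  have hθ' : T.pull p' (Y ⊞ S.X₁) (T.cls hS₂) = 0 := by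
    rw [hθ, map_add, ← T.pull_push_apply, ← T.pull_push_apply, hξ', hν, map_zero, map_zero, add_zero]
  obtain ⟨t, ht⟩ := (T.pull_cls_eq_zero_iff hS₂ p').1 hθ'
  dsimp only at t ht
  have : Mono j := hS₂.mono_f
  obtain ⟨s, hs⟩ : ∃ s : E₂ ⟶ Y ⊞ S.X₁, s ≫ j = m ≫ t - 𝟙 E₂ := by
    have h0 : (m ≫ t - 𝟙 E₂) ≫ q = 0 := by
      rw [Preadditive.sub_comp, Category.assoc, ht, hp, Category.id_comp, sub_self]
    exact ⟨hS₂.exact.lift _ h0, hS₂.exact.lift_f _ h0⟩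
  obtain ⟨a, ha⟩ : ∃ a : S.X₁ ⟶ Y ⊞ S.X₁, a ≫ j = i' ≫ t := by
    have h0 : (i' ≫ t) ≫ q = 0 := by rw [Category.assoc, ht, w']
    exact ⟨hS₂.exact.lift _ h0, hS₂.exact.lift_f _ h0⟩
  have hjs : j ≫ s = biprod.snd ≫ a - 𝟙 _ := by
    rw [← cancel_mono j, Category.assoc, hs, Preadditive.comp_sub, ← Category.assoc, hm,
      Preadditive.sub_comp, Category.assoc, Category.assoc, ha, Category.id_comp,
      Category.comp_id]
  have hext := (T.push_cls_eq_zero_iff hS₂ (biprod.snd ≫ a ≫ biprod.fst - biprod.fst)).2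
    ⟨s ≫ biprod.fst, by
      rw [← Category.assoc]
      dsimp only
      rw [hjs, Preadditive.sub_comp, Category.id_comp, Category.assoc]⟩
  refine ⟨a ≫ biprod.fst, ?_⟩
  rw [hθ, map_add] at hext
  dsimp only at hext
  rw [← T.push_comp_apply, ← T.push_comp_apply, Preadditive.comp_sub,
    Preadditive.comp_sub, biprod.inl_snd_assoc, biprod.inl_fst, biprod.inr_snd_assoc,
    biprod.inr_fst, zero_comp, sub_zero, T.push_sub,
    T.push_zero, T.push_id, LinearMap.sub_apply, LinearMap.zero_apply, LinearMap.id_apply,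
    zero_sub] at hext
  exact neg_add_eq_zero.1 hext

/-- The pairing `Hom̲(Y,M) × Ext(M,X) → k`, `(g, ν) ↦ γ(ν.g)`, defined by a functional `γ` on
`Ext(Y,X)`. -/
def pullPairing {Y X : C} (γ : Module.Dual k (T.ext Y X)) (M : C) :
    HomUnder T Y M →ₗ[k] T.ext M X →ₗ[k] k :=
  (PTriv T Y M).liftQ
    { toFun := fun g => γ ∘ₗ T.pull g X
      map_add' := fun g h => by rw [T.pull_add, LinearMap.comp_add]
      map_smul' := fun a g => by rw [T.pull_smul, LinearMap.comp_smul]; rfl }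
    (fun g hg => by
      change γ ∘ₗ T.pull g X = 0
      rw [mem_PTriv.1 hg X, LinearMap.comp_zero])

/-- The pairing `Hom̄(M,Y) × Ext(X,M) → k`, `(g, ν) ↦ γ(g.ν)`, defined by a functional `γ` on
`Ext(X,Y)`. -/
def pushPairing {X Y : C} (γ : Module.Dual k (T.ext X Y)) (M : C) :
    HomBar T M Y →ₗ[k] T.ext X M →ₗ[k] k :=
  (ITriv T M Y).liftQ
    { toFun := fun g => γ ∘ₗ T.push X g
      map_add' := fun g h => by rw [T.push_add, LinearMap.comp_add]
      map_smul' := fun a g => by rw [T.push_smul, LinearMap.comp_smul]; rfl }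
    (fun g hg => by
      change γ ∘ₗ T.push X g = 0
      rw [mem_ITriv.1 hg X, LinearMap.comp_zero])

lemma pullPairing_mk {Y X : C} (γ : Module.Dual k (T.ext Y X)) {M : C} (g : Y ⟶ M)
    (ν : T.ext M X) :
    T.pullPairing γ M (Submodule.Quotient.mk g) ν = γ (T.pull g X ν) := rfl

lemma pushPairing_mk {X Y : C} (γ : Module.Dual k (T.ext X Y)) {M : C} (g : M ⟶ Y)
    (ν : T.ext X M) :
    T.pushPairing γ M (Submodule.Quotient.mk g) ν = γ (T.push X g ν) := rfl

end YonedaExt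

/-- A functional vanishing on the kernel of a linear map factors through that map. -/
lemma exists_dual_comp_eq {V W : Type*} [AddCommGroup V] [Module k V] [AddCommGroup W]
    [Module k W] (γ : Module.Dual k V) (L : V →ₗ[k] W) (h : ∀ v, L v = 0 → γ v = 0) :
    ∃ φ : Module.Dual k W, ∀ v, γ v = φ (L v) := by
  have hγ : γ ∈ LinearMap.range L.dualMap := by
    rw [LinearMap.range_dualMap_eq_dualAnnihilator_ker, Submodule.mem_dualAnnihilator]
    exact fun v hv => h v (LinearMap.mem_ker.1 hv)
  obtain ⟨φ, rfl⟩ := hγ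
  exact ⟨φ, fun _ => rfl⟩

variable {T : YonedaExt k C}

/-- If `X` represents `D Ext(Y,-)` on `C̄`, then `Y` represents `D Ext(-,X)` on `C̲`. -/
lemma RepresentsR.representsL (homFinite : ∀ X Y : C, FiniteDimensional k (X ⟶ Y)) {Y X : C}
    (hYX : RepresentsR T Y X) : RepresentsL T X Y := by
  obtain ⟨e, he⟩ := hYX
  set γ := e X (Submodule.Quotient.mk (𝟙 X)) with hγ
  have hef : ∀ {M : C} (f : M ⟶ X) (μ : T.ext Y M),
      e M (Submodule.Quotient.mk f) μ = γ (T.push Y f μ) := fun f μ => by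
    rw [hγ, ← he, Category.comp_id]
  have inj : ∀ M, Function.Injective (T.pullPairing γ M) := fun M => by
    refine (injective_iff_map_eq_zero _).2 fun g' hg => ?_
    obtain ⟨g, rfl⟩ := Submodule.Quotient.mk_surjective _ g'
    rw [Submodule.Quotient.mk_eq_zero]
    refine mem_PTriv.2 fun Z => LinearMap.ext fun μ => ?_
    refine (Module.forall_dual_apply_eq_zero_iff k _).1 fun φ => ?_
    obtain ⟨f', rfl⟩ := (e Z).surjective φ
    obtain ⟨f, rfl⟩ := Submodule.Quotient.mk_surjective _ f'
    rw [hef, T.pull_push_apply, ← T.pullPairing_mk, hg, LinearMap.zero_apply]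
  have inj' : ∀ M, Function.Injective (T.pullPairing γ M).flip := fun M => by
    refine (injective_iff_map_eq_zero _).2 fun ν hν => ?_
    obtain ⟨E, i, p, w, hS, rfl⟩ := T.cls_surjective M X ν
    obtain ⟨φ, hφ⟩ := exists_dual_comp_eq γ (T.push Y i) fun ξ hξ => by
      obtain ⟨g, rfl⟩ := T.exists_eq_pull_cls hS ξ hξ
      exact LinearMap.congr_fun hν (Submodule.Quotient.mk g)
    obtain ⟨f', rfl⟩ := (e E).surjective φ
    obtain ⟨f, rfl⟩ := Submodule.Quotient.mk_surjective _ f'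
    have h1 : (Submodule.Quotient.mk (𝟙 X) : HomBar T X X) = Submodule.Quotient.mk (i ≫ f) :=
      (e X).injective (LinearMap.ext fun ξ => by rw [he, ← hφ])
    have h2 := mem_ITriv.1 ((Submodule.Quotient.eq _).1 h1) M
    have h3 : T.push M i (T.cls hS) = 0 :=
      (T.push_cls_eq_zero_iff hS i).2 ⟨𝟙 _, Category.comp_id _⟩
    rw [T.push_sub, T.push_id, sub_eq_zero] at h2
    calc T.cls hS = T.push M (i ≫ f) (T.cls hS) := LinearMap.congr_fun h2 _
      _ = 0 := by rw [T.push_comp_apply, h3, map_zero]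
  have perf : ∀ M, (T.pullPairing γ M).IsPerfPair := fun M => by
    have := homFinite Y M
    exact .of_injective (inj M) (inj' M)
  refine ⟨fun M => (T.pullPairing γ M).toPerfPair, fun M M' h g μ => ?_⟩
  rw [LinearMap.toPerfPair_apply, LinearMap.toPerfPair_apply, T.pullPairing_mk,
    T.pullPairing_mk, T.pull_comp_apply]

/-- If `X` represents `D Ext(-,Y)` on `C̲`, then `Y` represents `D Ext(X,-)` on `C̄`. -/
lemma RepresentsL.representsR (homFinite : ∀ X Y : C, FiniteDimensional k (X ⟶ Y)) {Y X : C}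
    (hYX : RepresentsL T Y X) : RepresentsR T X Y := by
  obtain ⟨e, he⟩ := hYX
  set γ := e X (Submodule.Quotient.mk (𝟙 X)) with hγ
  have hef : ∀ {M : C} (f : X ⟶ M) (μ : T.ext M Y),
      e M (Submodule.Quotient.mk f) μ = γ (T.pull f Y μ) := fun f μ => by
    rw [hγ, ← he, Category.id_comp]
  have inj : ∀ M, Function.Injective (T.pushPairing γ M) := fun M => by
    refine (injective_iff_map_eq_zero _).2 fun g' hg => ?_
    obtain ⟨g, rfl⟩ := Submodule.Quotient.mk_surjective _ g'
    rw [Submodule.Quotient.mk_eq_zero]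
    refine mem_ITriv.2 fun Z => LinearMap.ext fun μ => ?_
    refine (Module.forall_dual_apply_eq_zero_iff k _).1 fun φ => ?_
    obtain ⟨f', rfl⟩ := (e Z).surjective φ
    obtain ⟨f, rfl⟩ := Submodule.Quotient.mk_surjective _ f'
    rw [hef, ← T.pull_push_apply, ← T.pushPairing_mk, hg, LinearMap.zero_apply]
  have inj' : ∀ M, Function.Injective (T.pushPairing γ M).flip := fun M => by
    refine (injective_iff_map_eq_zero _).2 fun ν hν => ?_
    obtain ⟨E, i, p, w, hS, rfl⟩ := T.cls_surjective X M ν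
    obtain ⟨φ, hφ⟩ := exists_dual_comp_eq γ (T.pull p Y) fun ξ hξ => by
      obtain ⟨g, rfl⟩ := T.exists_eq_push_cls hS ξ hξ
      exact LinearMap.congr_fun hν (Submodule.Quotient.mk g)
    obtain ⟨f', rfl⟩ := (e E).surjective φ
    obtain ⟨f, rfl⟩ := Submodule.Quotient.mk_surjective _ f'
    have h1 : (Submodule.Quotient.mk (𝟙 X) : HomUnder T X X) = Submodule.Quotient.mk (f ≫ p) :=
      (e X).injective (LinearMap.ext fun ξ => by rw [he, ← hφ])
    have h2 := mem_PTriv.1 ((Submodule.Quotient.eq _).1 h1) M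
    have h3 : T.pull p M (T.cls hS) = 0 :=
      (T.pull_cls_eq_zero_iff hS p).2 ⟨𝟙 _, Category.id_comp _⟩
    rw [T.pull_sub, T.pull_id, sub_eq_zero] at h2
    calc T.cls hS = T.pull (f ≫ p) M (T.cls hS) := LinearMap.congr_fun h2 _
      _ = 0 := by rw [T.pull_comp_apply, h3, map_zero]
  have perf : ∀ M, (T.pushPairing γ M).IsPerfPair := fun M => by
    have := homFinite M Y
    exact .of_injective (inj M) (inj' M)
  refine ⟨fun M => (T.pushPairing γ M).toPerfPair, fun M M' h f μ => ?_⟩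
  rw [LinearMap.toPerfPair_apply, LinearMap.toPerfPair_apply, T.pushPairing_mk,
    T.pushPairing_mk, T.push_comp_apply]

/-- Objects representing the same functor on `C̲` are isomorphic in `C̲`. -/
lemma RepresentsL.stablyIsoP {X A B : C} (hA : RepresentsL T X A) (hB : RepresentsL T X B) :
    StablyIsoP T A B := by
  obtain ⟨eA, hA⟩ := hA
  obtain ⟨eB, hB⟩ := hB
  obtain ⟨f', hf⟩ := (eA B).surjective (eB B (Submodule.Quotient.mk (𝟙 B)))
  obtain ⟨f, rfl⟩ := Submodule.Quotient.mk_surjective _ f'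
  obtain ⟨g', hg⟩ := (eB A).surjective (eA A (Submodule.Quotient.mk (𝟙 A)))
  obtain ⟨g, rfl⟩ := Submodule.Quotient.mk_surjective _ g'
  refine ⟨f, g, (Submodule.Quotient.eq _).1 ((eA A).injective (LinearMap.ext fun μ => ?_)),
    (Submodule.Quotient.eq _).1 ((eB B).injective (LinearMap.ext fun μ => ?_))⟩
  · rw [hA, hf, ← hB, Category.id_comp, hg]
  · rw [hB, hg, ← hA, Category.id_comp, hf]

/-- Objects representing the same functor on `C̄` are isomorphic in `C̄`. -/
lemma RepresentsR.stablyIsoI {X A B : C} (hA : RepresentsR T X A) (hB : RepresentsR T X B) :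
    StablyIsoI T A B := by
  obtain ⟨eA, hA⟩ := hA
  obtain ⟨eB, hB⟩ := hB
  obtain ⟨f', hf⟩ := (eB A).surjective (eA A (Submodule.Quotient.mk (𝟙 A)))
  obtain ⟨f, rfl⟩ := Submodule.Quotient.mk_surjective _ f'
  obtain ⟨g', hg⟩ := (eA B).surjective (eB B (Submodule.Quotient.mk (𝟙 B)))
  obtain ⟨g, rfl⟩ := Submodule.Quotient.mk_surjective _ g'
  refine ⟨f, g, (Submodule.Quotient.eq _).1 ((eA A).injective (LinearMap.ext fun μ => ?_)),
    (Submodule.Quotient.eq _).1 ((eB B).injective (LinearMap.ext fun μ => ?_))⟩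
  · rw [hA, hg, ← hB, Category.comp_id, hf]
  · rw [hB, hf, ← hA, Category.comp_id, hg]

/-- **Lemma 3.2**.  (1) If `Y ∈ C_r` then `τY ∈ C_l` and `τ⁻τY ≅ Y` in `C̲`, for any choices
`tY` of `τY` and `ttY` of `τ⁻(τY)`.  (2) Dually, if `Y ∈ C_l` then `τ⁻Y ∈ C_r` and
`ττ⁻Y ≅ Y` in `C̄`. -/
theorem lemma_tauminus_tau
    (homFinite : ∀ X Y : C, FiniteDimensional k (X ⟶ Y))
    (T : YonedaExt k C) (Y : C) :
    (∀ tY : C, RepresentsR T Y tY →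
      MemCl T tY ∧ ∀ ttY : C, RepresentsL T tY ttY → StablyIsoP T ttY Y) ∧
    (∀ tY : C, RepresentsL T Y tY →
      MemCr T tY ∧ ∀ ttY : C, RepresentsR T tY ttY → StablyIsoI T ttY Y) := by
  exact ⟨fun tY h => ⟨⟨Y, h.representsL homFinite⟩,
      fun _ h' => h'.stablyIsoP (h.representsL homFinite)⟩,
    fun tY h => ⟨⟨Y, h.representsR homFinite⟩,
      fun _ h' => h'.stablyIsoI (h.representsR homFinite)⟩⟩

end GenAR
end
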